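/- Let p₁(·), p₂(·) : ℝⁿ → [1,∞) be measurable exponent functions (no log-Hölder continuity assumed), define p(·) by 1/p(x) = 1/p₁(x) + 1/p₂(x), and let w₁, w₂ be weights with w = w₁w₂. If the bilinear maximal operator satisfies ‖M(f₁,f₂)w‖_{p(·)} ≤ C‖f₁w₁‖_{p₁(·)}‖f₂w₂‖_{p₂(·)} for all f₁ ∈ L^{p₁(·)}(w₁) and f₂ ∈ L^{p₂(·)}(w₂), then (w₁,w₂,w) ∈ A_{p⃗(·)}. -/

import Mathlib

open MeasureTheory ENNReal Set

noncomputable section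

/-- Euclidean space `ℝⁿ`. -/
abbrev Rn (n : ℕ) : Type := Fin n → ℝ

/-- A cube in `ℝⁿ` with sides parallel to the coordinate axes. -/
structure Cube (n : ℕ) : Type where
  base : Fin n → ℝ
  side : ℝ
  side_pos : 0 < side

namespace Cube

/-- The set of points of a cube. -/
def toSet {n : ℕ} (Q : Cube n) : Set (Rn n) :=
  {x | ∀ i, Q.base i ≤ x i ∧ x i < Q.base i + Q.side}

/-- The volume `|Q|` of a cube. -/
def vol {n : ℕ} (Q : Cube n) : ℝ≥0∞ := ENNReal.ofReal (Q.side ^ n)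

/-- Membership in the standard dyadic grid `𝒟₀`. -/
def IsDyadic {n : ℕ} (Q : Cube n) : Prop :=
  ∃ (k : ℤ) (j : Fin n → ℤ), Q.side = (2 : ℝ) ^ (-k) ∧
    ∀ i, Q.base i = (2 : ℝ) ^ (-k) * (j i : ℝ)

end Cube

/-- The modular associated to an extended-real-valued exponent `r(·)`:
`ρ(f/λ) = ∫_{r ≠ ∞} (f/λ)^{r(x)} dμ + ‖f/λ‖_{L^∞({r = ∞})}`. -/
def eModular {n : ℕ} (r : Rn n → ℝ≥0∞) (μ : Measure (Rn n)) (f : Rn n → ℝ≥0∞)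
    (lam : ℝ≥0∞) : ℝ≥0∞ :=
  (∫⁻ x in {x | r x ≠ ∞}, (f x / lam) ^ (r x).toReal ∂μ)
    + essSup (fun x => f x / lam) (μ.restrict {x | r x = ∞})

/-- The variable Lebesgue (quasi)norm `‖f‖_{r(·)}` with respect to a measure `μ`. -/
def eNorm {n : ℕ} (r : Rn n → ℝ≥0∞) (μ : Measure (Rn n)) (f : Rn n → ℝ≥0∞) : ℝ≥0∞ :=
  sInf {lam : ℝ≥0∞ | lam ≠ 0 ∧ eModular r μ f lam ≤ 1}

/-- The variable Lebesgue norm of a real-valued function with respect to Lebesgue measure. -/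
def vNorm {n : ℕ} (r : Rn n → ℝ≥0∞) (f : Rn n → ℝ) : ℝ≥0∞ :=
  eNorm r volume fun x => ENNReal.ofReal |f x|

/-- View a real-valued exponent as an extended-real-valued one. -/
def ofExp {n : ℕ} (p : Rn n → ℝ) : Rn n → ℝ≥0∞ := fun x => ENNReal.ofReal (p x)

/-- The conjugate of an extended real exponent: `1/t + 1/t' = 1`. -/
def econj (t : ℝ≥0∞) : ℝ≥0∞ :=
  if t = 1 then ∞ else if t = ∞ then 1 else ENNReal.ofReal (t.toReal / (t.toReal - 1))

/-- The pointwise conjugate exponent `p'(·)` of a real-valued exponent. -/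
def conjExp {n : ℕ} (p : Rn n → ℝ) : Rn n → ℝ≥0∞ := fun x => econj (ENNReal.ofReal (p x))

/-- A weight: a measurable function that is positive (and finite) a.e. -/
def IsWeight {n : ℕ} (w : Rn n → ℝ) : Prop :=
  Measurable w ∧ ∀ᵐ x ∂(volume : Measure (Rn n)), 0 < w x

/-- Local log-Hölder continuity `LH₀`. -/
def LH0 {n : ℕ} (p : Rn n → ℝ) : Prop :=
  ∃ C₀ > 0, ∀ x y : Rn n, dist x y < 1 / 2 →
    |1 / p x - 1 / p y| ≤ C₀ / (-Real.log (dist x y))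

/-- Log-Hölder continuity at infinity with a given asymptotic value `pinf`. -/
def LHinfWith {n : ℕ} (p : Rn n → ℝ) (pinf : ℝ) : Prop :=
  ∃ C > 0, ∀ x : Rn n, |1 / p x - 1 / pinf| ≤ C / Real.log (Real.exp 1 + ‖x‖)

/-- Log-Hölder continuity at infinity `LH∞`. -/
def LHinf {n : ℕ} (p : Rn n → ℝ) : Prop := ∃ pinf > 0, LHinfWith p pinf

/-- Log-Hölder continuity `LH = LH₀ ∩ LH∞`. -/
def LH {n : ℕ} (p : Rn n → ℝ) : Prop := LH0 p ∧ LHinf p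

/-- The bilinear variable Muckenhoupt condition `(w₁,w₂,w) ∈ A_{p⃗(·)}`. -/
def ApVec {n : ℕ} (p₁ p₂ p w₁ w₂ w : Rn n → ℝ) : Prop :=
  ∃ C : ℝ≥0∞, C ≠ ∞ ∧ ∀ Q : Cube n,
    Q.vol⁻¹ ^ 2 * vNorm (ofExp p) (Q.toSet.indicator w) *
      vNorm (conjExp p₁) (Q.toSet.indicator fun x => (w₁ x)⁻¹) *
      vNorm (conjExp p₂) (Q.toSet.indicator fun x => (w₂ x)⁻¹) ≤ C

/-- The variable Muckenhoupt class `A_{r(·)}` for an extended-real-valued exponent. -/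
def ApVarE {n : ℕ} (r : Rn n → ℝ≥0∞) (v : Rn n → ℝ) : Prop :=
  ∃ C : ℝ≥0∞, C ≠ ∞ ∧ ∀ Q : Cube n,
    Q.vol⁻¹ * vNorm r (Q.toSet.indicator v) *
      vNorm (fun x => econj (r x)) (Q.toSet.indicator fun x => (v x)⁻¹) ≤ C

/-- The bilinear maximal operator `M(f₁,f₂)`. -/
def biMax {n : ℕ} (f₁ f₂ : Rn n → ℝ) (x : Rn n) : ℝ≥0∞ :=
  ⨆ (Q : Cube n) (_ : x ∈ Q.toSet),
    (Q.vol⁻¹ * ∫⁻ y in Q.toSet, ENNReal.ofReal |f₁ y|) *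
      (Q.vol⁻¹ * ∫⁻ y in Q.toSet, ENNReal.ofReal |f₂ y|)

/-- The dyadic bilinear maximal operator `M^d(f₁,f₂)`. -/
def biMaxD {n : ℕ} (f₁ f₂ : Rn n → ℝ) (x : Rn n) : ℝ≥0∞ :=
  ⨆ (Q : Cube n) (_ : Q.IsDyadic) (_ : x ∈ Q.toSet),
    (Q.vol⁻¹ * ∫⁻ y in Q.toSet, ENNReal.ofReal |f₁ y|) *
      (Q.vol⁻¹ * ∫⁻ y in Q.toSet, ENNReal.ofReal |f₂ y|)

/-- The bilinear averaging operator `A_Q(f₁,f₂) = (⨍_Q f₁)(⨍_Q f₂)χ_Q`. -/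
def avgOp {n : ℕ} (Q : Cube n) (f₁ f₂ : Rn n → ℝ) (x : Rn n) : ℝ≥0∞ :=
  Q.toSet.indicator
    (fun _ =>
      (Q.vol⁻¹ * ∫⁻ y in Q.toSet, ENNReal.ofReal |f₁ y|) *
        (Q.vol⁻¹ * ∫⁻ y in Q.toSet, ENNReal.ofReal |f₂ y|)) x

/-- `(p)₋(Q)`, the essential infimum of `p` on a cube `Q`. -/
def pMinusOn {n : ℕ} (p : Rn n → ℝ) (Q : Cube n) : ℝ :=
  essInf p (volume.restrict Q.toSet)

/-- The exponent `q(Q)` with `1/q(Q) = 1/(p₁)₋(Q) + 1/(p₂)₋(Q)`. -/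
def qExp {n : ℕ} (p₁ p₂ : Rn n → ℝ) (Q : Cube n) : ℝ :=
  ((pMinusOn p₁ Q)⁻¹ + (pMinusOn p₂ Q)⁻¹)⁻¹

lemma eModular_mono_ae {n : ℕ} (r : Rn n → ℝ≥0∞) (μ : Measure (Rn n)) {f g : Rn n → ℝ≥0∞}
    (hfg : ∀ᵐ x ∂μ, f x ≤ g x) (lam : ℝ≥0∞) : eModular r μ f lam ≤ eModular r μ g lam := by
  unfold eModular
  gcongr ?_ + ?_
  · refine lintegral_mono_ae ?_
    filter_upwards [ae_restrict_of_ae hfg] with x hx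
    gcongr
  · refine essSup_mono_ae ?_
    filter_upwards [ae_restrict_of_ae hfg] with x hx
    gcongr

lemma eNorm_mono_ae {n : ℕ} (r : Rn n → ℝ≥0∞) (μ : Measure (Rn n)) {f g : Rn n → ℝ≥0∞}
    (hfg : ∀ᵐ x ∂μ, f x ≤ g x) : eNorm r μ f ≤ eNorm r μ g :=
  sInf_le_sInf fun lam h => ⟨h.1, (eModular_mono_ae r μ hfg lam).trans h.2⟩

lemma mul_eNorm_le_of_ne_top {n : ℕ} (r : Rn n → ℝ≥0∞) (μ : Measure (Rn n)) (f : Rn n → ℝ≥0∞)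
    {c : ℝ≥0∞} (hc : c ≠ ∞) : c * eNorm r μ f ≤ eNorm r μ fun x => c * f x := by
  rcases eq_or_ne c 0 with rfl | hc0
  · simp
  refine le_sInf fun lam ⟨hlam, hmod⟩ => ?_
  have hle : eNorm r μ f ≤ lam / c := by
    refine sInf_le ⟨(ENNReal.div_pos hlam hc).ne', ?_⟩
    have hdiv : ∀ x, f x / (lam / c) = c * f x / lam := fun x => by
      rw [div_eq_mul_inv, ENNReal.inv_div (Or.inl hc) (Or.inl hc0), div_eq_mul_inv, div_eq_mul_inv]
      ring
    simpa only [eModular, hdiv] using hmod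
  calc c * eNorm r μ f ≤ c * (lam / c) := by gcongr
    _ = lam := ENNReal.mul_div_cancel hc0 hc

lemma mul_eNorm_le {n : ℕ} (r : Rn n → ℝ≥0∞) (μ : Measure (Rn n)) (f : Rn n → ℝ≥0∞)
    (c : ℝ≥0∞) : c * eNorm r μ f ≤ eNorm r μ fun x => c * f x := by
  rcases eq_or_ne c ∞ with rfl | hc
  · conv_lhs => rw [← ENNReal.iSup_natCast, ENNReal.iSup_mul]
    refine iSup_le fun k => (mul_eNorm_le_of_ne_top r μ f (ENNReal.natCast_ne_top k)).trans ?_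
    exact eNorm_mono_ae r μ (.of_forall fun x => by gcongr; exact le_top)
  · exact mul_eNorm_le_of_ne_top r μ f hc

lemma vNorm_ofExp_le_one {n : ℕ} {p : Rn n → ℝ} (hp : ∀ x, 0 ≤ p x) {f : Rn n → ℝ}
    (hf : ∫⁻ x, ENNReal.ofReal |f x| ^ p x ≤ 1) : vNorm (ofExp p) f ≤ 1 := by
  refine sInf_le ⟨one_ne_zero, ?_⟩
  simpa [eModular, ofExp, ENNReal.toReal_ofReal (hp _)] using hf

lemma conjExp_eq_top_iff {n : ℕ} {p : Rn n → ℝ} {x : Rn n} : conjExp p x = ∞ ↔ p x = 1 := by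
  simp [conjExp, econj]

lemma toReal_conjExp {n : ℕ} {p : Rn n → ℝ} {x : Rn n} (hx : 1 < p x) :
    (conjExp p x).toReal = p x / (p x - 1) := by
  have h0 : 0 ≤ p x := by linarith
  rw [conjExp, econj, if_neg (by simpa using hx.ne'), if_neg ENNReal.ofReal_ne_top,
    ENNReal.toReal_ofReal h0, ENNReal.toReal_ofReal (div_nonneg h0 (by linarith))]

/-- If `∫ |f g| ≤ S` for all `f` in the unit ball of `L^{p(·)}`, then `|g| ≤ lam` a.e. on `{p = 1}`
for every `lam > S`. -/
lemma ae_le_of_dual_bound {n : ℕ} {p : Rn n → ℝ} (hpm : Measurable p) (hp1 : ∀ x, 1 ≤ p x)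
    {g : Rn n → ℝ} (hg : Measurable g) {S lam : ℝ≥0∞}
    (hS : ∀ f : Rn n → ℝ, Measurable f → vNorm (ofExp p) f ≤ 1 →
      ∫⁻ x, ENNReal.ofReal |f x| * ENNReal.ofReal |g x| ≤ S) (hlam : S < lam) :
    ∀ᵐ x ∂(volume : Measure (Rn n)), p x = 1 → ENNReal.ofReal |g x| ≤ lam := by
  by_contra hnot
  set A : Set (Rn n) := {x | p x = 1 ∧ lam < ENNReal.ofReal |g x|} with hA
  have hAm : MeasurableSet A :=
    (measurableSet_eq_fun hpm measurable_const).inter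
      (measurableSet_lt measurable_const hg.abs.ennreal_ofReal)
  have hApos : volume A ≠ 0 := by
    simpa [ae_iff, hA] using hnot
  obtain ⟨E, hEm, hEA, hE0, hEtop⟩ :=
    Measure.exists_subset_measure_lt_top hAm (pos_iff_ne_zero.2 hApos)
  set f : Rn n → ℝ := E.indicator fun _ => ((volume E)⁻¹).toReal with hf
  have hinv : (volume E)⁻¹ ≠ ∞ := ENNReal.inv_ne_top.2 hE0.ne'
  have hfabs : ∀ x, ENNReal.ofReal |f x| = E.indicator (fun _ => (volume E)⁻¹) x := fun x => by
    by_cases hx : x ∈ E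
    · rw [hf, indicator_of_mem hx, indicator_of_mem hx, abs_of_nonneg ENNReal.toReal_nonneg,
        ENNReal.ofReal_toReal hinv]
    · simp [hf, hx]
  have hnorm : vNorm (ofExp p) f ≤ 1 := by
    refine vNorm_ofExp_le_one (fun x => by linarith [hp1 x]) ?_
    have hpow : ∀ x, ENNReal.ofReal |f x| ^ p x = E.indicator (fun _ => (volume E)⁻¹) x := by
      intro x
      rw [hfabs]
      by_cases hx : x ∈ E
      · simp [hx, (hEA hx).1]
      · simp [hx, zero_lt_one.trans_le (hp1 x)]
    simp only [hpow]
    rw [lintegral_indicator_const hEm, ENNReal.inv_mul_cancel hE0.ne' hEtop.ne]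
  have hint := hS f (measurable_const.indicator hEm) hnorm
  have hlower : lam ≤ ∫⁻ x, ENNReal.ofReal |f x| * ENNReal.ofReal |g x| := by
    calc lam = ∫⁻ x, E.indicator (fun _ => (volume E)⁻¹ * lam) x := by
          rw [lintegral_indicator_const hEm, mul_right_comm,
            ENNReal.inv_mul_cancel hE0.ne' hEtop.ne, one_mul]
      _ ≤ _ := lintegral_mono fun x => by
          rw [hfabs]
          by_cases hx : x ∈ E
          · simp only [hx, indicator_of_mem]
            gcongr
            exact (hEA hx).2.le
          · simp [hx]
  exact absurd (hlower.trans hint) hlam.not_ge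

/-- If `∫ |f g| ≤ S` for all `f` in the unit ball of `L^{p(·)}`, then the integral part of the
conjugate modular of `g` at level `lam > S` is at most `1`. -/
lemma lintegral_conj_le_one_of_dual_bound {n : ℕ} {p : Rn n → ℝ} (hpm : Measurable p)
    (hp1 : ∀ x, 1 ≤ p x) {g : Rn n → ℝ} (hg : Measurable g) {S lam : ℝ≥0∞}
    (hS : ∀ f : Rn n → ℝ, Measurable f → vNorm (ofExp p) f ≤ 1 →
      ∫⁻ x, ENNReal.ofReal |f x| * ENNReal.ofReal |g x| ≤ S) (hlam : S < lam)
    (hlam_top : lam ≠ ∞) :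
    ∫⁻ x in {x | 1 < p x}, (ENNReal.ofReal |g x| / lam) ^ (p x / (p x - 1)) ≤ 1 := by
  have hlam0 : lam ≠ 0 := (zero_le.trans_lt hlam).ne'
  have hBm : MeasurableSet {x | 1 < p x} := measurableSet_lt measurable_const hpm
  rw [← lintegral_indicator hBm]
  set h : Rn n → ℝ≥0∞ :=
    {x | 1 < p x}.indicator fun x => (ENNReal.ofReal |g x| / lam) ^ (p x / (p x - 1)) with hh
  have hhm : Measurable h := Measurable.indicator (by fun_prop) hBm
  have hh_top : ∀ x, h x ≠ ∞ := fun x => by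
    by_cases hx : x ∈ {x | 1 < p x}
    · have hx1 : 1 < p x := hx
      rw [hh, indicator_of_mem hx]
      exact ENNReal.rpow_ne_top_of_nonneg (div_nonneg (by linarith) (by linarith))
        (ENNReal.div_ne_top ENNReal.ofReal_ne_top hlam0)
    · simp [hh, indicator_of_notMem hx]
  by_contra! hgt
  rw [← lintegral_congr fun x => ENNReal.coe_toNNReal (hh_top x)] at hgt
  obtain ⟨φ, hφh, hφtop, hφgt⟩ := exists_lt_lintegral_simpleFunc_of_lt_lintegral hgt
  set m : ℝ≥0∞ := ∫⁻ x, φ x with hm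
  have hm0 : m ≠ 0 := (zero_lt_one.trans hφgt).ne'
  have ht1 : m⁻¹ ≤ 1 := ENNReal.inv_le_one.2 hφgt.le
  have httop : m⁻¹ ≠ ∞ := ENNReal.inv_ne_top.2 hm0
  set f : Rn n → ℝ := fun x => ((m⁻¹ * φ x) ^ (1 / p x)).toReal with hf
  have hp0 : ∀ x, 0 < p x := fun x => zero_lt_one.trans_le (hp1 x)
  have hφm : Measurable fun x => (φ x : ℝ≥0∞) := φ.measurable.coe_nnreal_ennreal
  have hfm : Measurable f := by fun_prop
  have hfabs : ∀ x, ENNReal.ofReal |f x| = (m⁻¹ * φ x) ^ (1 / p x) := fun x => by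
    rw [hf, abs_of_nonneg ENNReal.toReal_nonneg, ENNReal.ofReal_toReal]
    exact ENNReal.rpow_ne_top_of_nonneg (by have := hp0 x; positivity)
      (ENNReal.mul_ne_top httop ENNReal.coe_ne_top)
  have hnorm : vNorm (ofExp p) f ≤ 1 := by
    refine vNorm_ofExp_le_one (fun x => (hp0 x).le) ?_
    have hpow : ∀ x, ENNReal.ofReal |f x| ^ p x = m⁻¹ * φ x := fun x => by
      rw [hfabs, ← ENNReal.rpow_mul, one_div_mul_cancel (hp0 x).ne', ENNReal.rpow_one]
    simp only [hpow]
    rw [lintegral_const_mul _ hφm, ENNReal.inv_mul_cancel hm0 hφtop.ne]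
  have hlower : lam ≤ ∫⁻ x, ENNReal.ofReal |f x| * ENNReal.ofReal |g x| := by
    calc lam = ∫⁻ x, (lam * m⁻¹) * φ x := by
          rw [lintegral_const_mul _ hφm, mul_assoc, ENNReal.inv_mul_cancel hm0 hφtop.ne, mul_one]
      _ ≤ _ := lintegral_mono fun x => ?_
    have hφx : (φ x : ℝ≥0∞) ≤ h x := by
      rw [← ENNReal.coe_toNNReal (hh_top x)]
      exact ENNReal.coe_le_coe.2 (hφh x)
    by_cases hx : 1 < p x
    · have hq : 0 < 1 - 1 / p x := by
        rw [sub_pos, div_lt_one (hp0 x)]; exact hx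
      have hg_eq : h x ^ (1 - 1 / p x) = ENNReal.ofReal |g x| / lam := by
        have hx' : x ∈ {x | 1 < p x} := hx
        rw [hh, indicator_of_mem hx', ← ENNReal.rpow_mul]
        have : p x / (p x - 1) * (1 - 1 / p x) = 1 := by
          have h1 := (hp0 x).ne'
          have h2 : p x - 1 ≠ 0 := by linarith
          field_simp
        rw [this, ENNReal.rpow_one]
      have hle : m⁻¹ * φ x ≤ (m⁻¹ * φ x) ^ (1 / p x) * (ENNReal.ofReal |g x| / lam) := by
        calc m⁻¹ * φ x = (m⁻¹ * φ x) ^ (1 / p x) * (m⁻¹ * φ x) ^ (1 - 1 / p x) := by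
              rw [← ENNReal.rpow_add_of_nonneg _ _ (by have := hp0 x; positivity) hq.le,
                add_sub_cancel, ENNReal.rpow_one]
          _ ≤ (m⁻¹ * φ x) ^ (1 / p x) * h x ^ (1 - 1 / p x) := by
              gcongr
              exact (mul_le_of_le_one_left' ht1).trans hφx
          _ = _ := by rw [hg_eq]
      calc lam * m⁻¹ * φ x ≤ lam * ((m⁻¹ * φ x) ^ (1 / p x) * (ENNReal.ofReal |g x| / lam)) := by
            rw [mul_assoc]; gcongr
        _ = (m⁻¹ * φ x) ^ (1 / p x) * (lam * (ENNReal.ofReal |g x| / lam)) := by ring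
        _ = _ := by rw [ENNReal.mul_div_cancel hlam0 hlam_top, hfabs]
    · have : φ x = 0 := by simpa [hh, hx] using hφx
      simp [this]
  exact absurd (hlower.trans (hS f hfm hnorm)) hlam.not_ge

/-- Norm-conjugate inequality: up to the factor `2`, the `p'(·)`-norm is controlled by pairing with
the unit ball of `L^{p(·)}`. -/
lemma vNorm_conjExp_le {n : ℕ} {p : Rn n → ℝ} (hpm : Measurable p) (hp1 : ∀ x, 1 ≤ p x)
    {g : Rn n → ℝ} (hg : Measurable g) :
    vNorm (conjExp p) g ≤ 2 * ⨆ (f : Rn n → ℝ) (_ : Measurable f ∧ vNorm (ofExp p) f ≤ 1),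
      ∫⁻ x, ENNReal.ofReal |f x| * ENNReal.ofReal |g x| := by
  set S : ℝ≥0∞ := ⨆ (f : Rn n → ℝ) (_ : Measurable f ∧ vNorm (ofExp p) f ≤ 1),
    ∫⁻ x, ENNReal.ofReal |f x| * ENNReal.ofReal |g x| with hSdef
  have hS : ∀ f : Rn n → ℝ, Measurable f → vNorm (ofExp p) f ≤ 1 →
      ∫⁻ x, ENNReal.ofReal |f x| * ENNReal.ofReal |g x| ≤ S := fun f hf hf1 =>
    le_iSup₂_of_le f ⟨hf, hf1⟩ le_rfl
  rw [mul_comm, ← ENNReal.div_le_iff two_ne_zero ofNat_ne_top]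
  refine le_of_forall_gt_imp_ge_of_dense fun lam hlam => ?_
  rw [ENNReal.div_le_iff two_ne_zero ofNat_ne_top]
  rcases eq_or_ne lam ∞ with rfl | hlam_top
  · simp
  have hlam0 : lam ≠ 0 := (zero_le.trans_lt hlam).ne'
  have hhalf : ∀ a : ℝ≥0∞, a / (lam * 2) = a / lam * 2⁻¹ := fun a => by
    rw [div_eq_mul_inv, ENNReal.mul_inv (Or.inl hlam0) (Or.inl hlam_top), ← mul_assoc,
      div_eq_mul_inv a lam]
  refine sInf_le ⟨mul_ne_zero hlam0 two_ne_zero, ?_⟩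
  have hset : {x | conjExp p x ≠ ∞} = {x | 1 < p x} := by
    ext x
    simp [conjExp_eq_top_iff, (hp1 x).lt_iff_ne, eq_comm]
  have hset' : {x | conjExp p x = ∞} = {x | p x = 1} := by
    ext x
    simp [conjExp_eq_top_iff]
  have hBm : MeasurableSet {x | 1 < p x} := measurableSet_lt measurable_const hpm
  have hDm : MeasurableSet {x | p x = 1} := measurableSet_eq_fun hpm measurable_const
  rw [eModular, hset, hset', ← ENNReal.inv_two_add_inv_two]
  refine add_le_add ?_ ?_
  · calc ∫⁻ x in {x | 1 < p x}, (ENNReal.ofReal |g x| / (lam * 2)) ^ (conjExp p x).toReal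
        ≤ ∫⁻ x in {x | 1 < p x},
            2⁻¹ * (ENNReal.ofReal |g x| / lam) ^ (p x / (p x - 1)) := by
          refine setLIntegral_mono' hBm fun x hx => ?_
          have hx1 : 1 < p x := hx
          have hq : 1 ≤ p x / (p x - 1) := by
            rw [le_div_iff₀ (by linarith)]; linarith
          rw [toReal_conjExp hx1, hhalf, ENNReal.mul_rpow_of_nonneg _ _ (by linarith), mul_comm]
          gcongr
          exact ENNReal.rpow_le_self_of_le_one (by simp) hq
      _ ≤ 2⁻¹ := by
          rw [lintegral_const_mul _ (by fun_prop)]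
          exact mul_le_of_le_one_right'
            (lintegral_conj_le_one_of_dual_bound hpm hp1 hg hS hlam hlam_top)
  · refine essSup_le_of_ae_le _ ?_
    filter_upwards [(ae_restrict_iff' hDm).2 (ae_le_of_dual_bound hpm hp1 hg hS hlam)] with x hx
    rw [hhalf]
    exact mul_le_of_le_one_left' (ENNReal.div_le_of_le_mul (by rwa [one_mul]))

lemma Cube.measurableSet_toSet {n : ℕ} (Q : Cube n) : MeasurableSet Q.toSet := by
  have : Q.toSet = Set.univ.pi fun i => Set.Ico (Q.base i) (Q.base i + Q.side) := by
    ext x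
    simp [Cube.toSet]
  rw [this]
  exact MeasurableSet.univ_pi fun i => measurableSet_Ico

/-- A function `f` in the unit ball of `L^{p(·)}` gives the test function `f v⁻¹ χ_Q` in the unit
ball of `L^{p(·)}(v)`. -/
lemma vNorm_test_le {n : ℕ} {r : Rn n → ℝ≥0∞} (f v : Rn n → ℝ) (E : Set (Rn n))
    (hf : vNorm r f ≤ 1) :
    vNorm r (fun x => f x * E.indicator (fun y => (v y)⁻¹) x * v x) ≤ 1 := by
  refine (eNorm_mono_ae _ _ (.of_forall fun x => ENNReal.ofReal_le_ofReal ?_)).trans hf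
  by_cases hx : x ∈ E
  · rcases eq_or_ne (v x) 0 with hv | hv <;> simp [hx, hv]
  · simp [hx]

lemma setLIntegral_test {n : ℕ} (f u : Rn n → ℝ) {E : Set (Rn n)} (hE : MeasurableSet E) :
    ∫⁻ x in E, ENNReal.ofReal |f x * E.indicator u x| =
      ∫⁻ x, ENNReal.ofReal |f x| * ENNReal.ofReal |E.indicator u x| := by
  rw [← lintegral_indicator hE]
  refine lintegral_congr fun x => ?_
  by_cases hx : x ∈ E
  · simp [hx, abs_mul, ENNReal.ofReal_mul]
  · simp [hx]

lemma avg_mul_vNorm_le {n : ℕ} (r : Rn n → ℝ≥0∞) (f₁ f₂ : Rn n → ℝ) {w : Rn n → ℝ}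
    (hw : ∀ᵐ x ∂(volume : Measure (Rn n)), 0 < w x) (Q : Cube n) :
    (Q.vol⁻¹ * ∫⁻ y in Q.toSet, ENNReal.ofReal |f₁ y|) *
        (Q.vol⁻¹ * ∫⁻ y in Q.toSet, ENNReal.ofReal |f₂ y|) * vNorm r (Q.toSet.indicator w) ≤
      eNorm r volume fun x => biMax f₁ f₂ x * ENNReal.ofReal (w x) := by
  refine (mul_eNorm_le _ _ _ _).trans (eNorm_mono_ae _ _ ?_)
  filter_upwards [hw] with x hx
  by_cases hxQ : x ∈ Q.toSet
  · simp only [hxQ, indicator_of_mem, abs_of_pos hx]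
    gcongr
    exact le_iSup₂_of_le (f := fun (Q : Cube n) (_ : x ∈ Q.toSet) =>
      (Q.vol⁻¹ * ∫⁻ y in Q.toSet, ENNReal.ofReal |f₁ y|) *
        (Q.vol⁻¹ * ∫⁻ y in Q.toSet, ENNReal.ofReal |f₂ y|)) Q hxQ le_rfl
  · simp [hxQ]

/-- necessity of the `A_{p⃗(·)}` condition for the weighted bound of
the bilinear maximal operator; no log-Hölder continuity is assumed. -/
theorem statement18 {n : ℕ} (p₁ p₂ p w₁ w₂ w : Rn n → ℝ)
    (hp₁m : Measurable p₁) (hp₂m : Measurable p₂)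
    (hp₁1 : ∀ x, 1 ≤ p₁ x) (hp₂1 : ∀ x, 1 ≤ p₂ x)
    (hp : ∀ x, 1 / p x = 1 / p₁ x + 1 / p₂ x)
    (hw₁ : IsWeight w₁) (hw₂ : IsWeight w₂)
    (hw : ∀ x, w x = w₁ x * w₂ x)
    (hbdd : ∃ C : ℝ≥0∞, C ≠ ∞ ∧ ∀ f₁ f₂ : Rn n → ℝ, Measurable f₁ → Measurable f₂ →
      vNorm (ofExp p₁) (fun x => f₁ x * w₁ x) ≠ ∞ →
      vNorm (ofExp p₂) (fun x => f₂ x * w₂ x) ≠ ∞ →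
      eNorm (ofExp p) volume (fun x => biMax f₁ f₂ x * ENNReal.ofReal (w x)) ≤
        C * vNorm (ofExp p₁) (fun x => f₁ x * w₁ x) *
          vNorm (ofExp p₂) (fun x => f₂ x * w₂ x)) :
    ApVec p₁ p₂ p w₁ w₂ w := by
  obtain ⟨C, hC, hbdd⟩ := hbdd
  refine ⟨4 * C, ENNReal.mul_ne_top ofNat_ne_top hC, fun Q => ?_⟩
  have hwpos : ∀ᵐ x ∂(volume : Measure (Rn n)), 0 < w x := by
    filter_upwards [hw₁.2, hw₂.2] with x h1 h2
    rw [hw]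
    positivity
  have hg₁ : Measurable (Q.toSet.indicator fun x => (w₁ x)⁻¹) :=
    hw₁.1.inv.indicator Q.measurableSet_toSet
  have hg₂ : Measurable (Q.toSet.indicator fun x => (w₂ x)⁻¹) :=
    hw₂.1.inv.indicator Q.measurableSet_toSet
  set g₁ := Q.toSet.indicator fun x => (w₁ x)⁻¹ with hg₁_def
  set g₂ := Q.toSet.indicator fun x => (w₂ x)⁻¹ with hg₂_def
  have key : ∀ f₁ f₂ : Rn n → ℝ, Measurable f₁ ∧ vNorm (ofExp p₁) f₁ ≤ 1 →
      Measurable f₂ ∧ vNorm (ofExp p₂) f₂ ≤ 1 →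
      Q.vol⁻¹ ^ 2 * vNorm (ofExp p) (Q.toSet.indicator w) *
        (∫⁻ x, ENNReal.ofReal |f₁ x| * ENNReal.ofReal |g₁ x|) *
        (∫⁻ x, ENNReal.ofReal |f₂ x| * ENNReal.ofReal |g₂ x|) ≤ C := by
    intro f₁ f₂ ⟨hf₁, hf₁1⟩ ⟨hf₂, hf₂1⟩
    have h1 := vNorm_test_le f₁ w₁ Q.toSet hf₁1
    have h2 := vNorm_test_le f₂ w₂ Q.toSet hf₂1
    have hM := (avg_mul_vNorm_le (ofExp p) (fun x => f₁ x * g₁ x) (fun x => f₂ x * g₂ x)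
      hwpos Q).trans (hbdd _ _ (hf₁.mul hg₁) (hf₂.mul hg₂)
        (ne_top_of_le_ne_top one_ne_top h1) (ne_top_of_le_ne_top one_ne_top h2))
    rw [hg₁_def, hg₂_def, setLIntegral_test _ _ Q.measurableSet_toSet,
      setLIntegral_test _ _ Q.measurableSet_toSet] at hM
    calc _ = _ := by ring
      _ ≤ _ := hM
      _ ≤ C * 1 * 1 := by gcongr
      _ = C := by ring
  calc _ ≤ Q.vol⁻¹ ^ 2 * vNorm (ofExp p) (Q.toSet.indicator w) *
        (2 * ⨆ (f : Rn n → ℝ) (_ : Measurable f ∧ vNorm (ofExp p₁) f ≤ 1),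
          ∫⁻ x, ENNReal.ofReal |f x| * ENNReal.ofReal |g₁ x|) *
        (2 * ⨆ (f : Rn n → ℝ) (_ : Measurable f ∧ vNorm (ofExp p₂) f ≤ 1),
          ∫⁻ x, ENNReal.ofReal |f x| * ENNReal.ofReal |g₂ x|) := by
        gcongr
        · exact vNorm_conjExp_le hp₁m hp₁1 hg₁
        · exact vNorm_conjExp_le hp₂m hp₂1 hg₂
    _ = 4 * (Q.vol⁻¹ ^ 2 * vNorm (ofExp p) (Q.toSet.indicator w) *
        (⨆ (f : Rn n → ℝ) (_ : Measurable f ∧ vNorm (ofExp p₁) f ≤ 1),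
          ∫⁻ x, ENNReal.ofReal |f x| * ENNReal.ofReal |g₁ x|) *
        (⨆ (f : Rn n → ℝ) (_ : Measurable f ∧ vNorm (ofExp p₂) f ≤ 1),
          ∫⁻ x, ENNReal.ofReal |f x| * ENNReal.ofReal |g₂ x|)) := by ring
    _ ≤ 4 * C := by
        gcongr
        simp only [ENNReal.mul_iSup, ENNReal.iSup_mul]
        exact iSup₂_le fun f₂ hf₂ => iSup₂_le fun f₁ hf₁ => key f₁ f₂ hf₁ hf₂
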